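/- The number of interval orders on [n−1] is at most the number of interval graphs on [n]: g(n−1) ≤ f_1(n). -/

import Mathlib

/-- The number f₁(n) of interval graphs on the vertex set [n]. -/
noncomputable def numIntervalGraphs (n : ℕ) : ℕ :=
  Set.ncard {G : SimpleGraph (Fin n) |
    ∃ a b : Fin n → ℝ, (∀ k, a k ≤ b k) ∧
      ∀ i j : Fin n, G.Adj i j ↔
        (i ≠ j ∧ (Set.Icc (a i) (b i) ∩ Set.Icc (a j) (b j)).Nonempty)}

/-- The number g(n) of interval orders on [n]. -/
noncomputable def numIntervalOrders (n : ℕ) : ℕ :=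
  Set.ncard {r : Fin n → Fin n → Prop |
    ∃ a b : Fin n → ℝ, (∀ k, a k ≤ b k) ∧ ∀ i j : Fin n, r i j ↔ b i < a j}

/-- The intervals `[l i, u i]` in `{1, …, m}` represent the relation `r`, every `k` with `2 ≤ k ≤ m`
is a left endpoint, and every `k` with `1 ≤ k < m` is a right endpoint. -/
structure IsCompressedRep {V : Type*} (r : V → V → Prop) (l u : V → ℕ) (m : ℕ) : Prop where
  one_le_size : 1 ≤ m
  one_le_left (i : V) : 1 ≤ l i
  left_le_right (i : V) : l i ≤ u i
  right_le_size (i : V) : u i ≤ m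
  rel_iff (i j : V) : r i j ↔ u i < l j
  exists_left_eq (k : ℕ) : 2 ≤ k → k ≤ m → ∃ i, l i = k
  exists_right_eq (k : ℕ) : 1 ≤ k → k < m → ∃ i, u i = k

/-- Every representation by intervals in `{1, …, m}` can be compressed. -/
theorem exists_isCompressedRep_of_nat {V : Type*} (r : V → V → Prop) (m : ℕ) :
    ∀ l u : V → ℕ, 1 ≤ m → (∀ i, 1 ≤ l i) → (∀ i, l i ≤ u i) → (∀ i, u i ≤ m) →
      (∀ i j, r i j ↔ u i < l j) → ∃ l' u' m', IsCompressedRep r l' u' m' := by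
  induction m with
  | zero => intro l u h; omega
  | succ m ih =>
    intro l u hm hl hlu hu hr
    by_cases hL : ∀ k, 2 ≤ k → k ≤ m + 1 → ∃ i, l i = k
    · by_cases hU : ∀ k, 1 ≤ k → k < m + 1 → ∃ i, u i = k
      · exact ⟨l, u, m + 1, hm, hl, hlu, hu, hr, hL, hU⟩
      · push Not at hU
        obtain ⟨k, hk1, hkm, hk⟩ := hU
        refine ih (fun i => if k + 1 ≤ l i then l i - 1 else l i)
          (fun i => if k + 1 ≤ u i then u i - 1 else u i) (by omega) ?_ ?_ ?_ ?_
        · intro i; have := hl i; split_ifs <;> omega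
        · intro i; have := hlu i; split_ifs <;> omega
        · intro i; have := hu i; split_ifs <;> omega
        · intro i j; have := hk i; rw [hr]; split_ifs <;> omega
    · push Not at hL
      obtain ⟨k, hk1, hkm, hk⟩ := hL
      refine ih (fun i => if k ≤ l i then l i - 1 else l i)
        (fun i => if k ≤ u i then u i - 1 else u i) (by omega) ?_ ?_ ?_ ?_
      · intro i; have := hl i; split_ifs <;> omega
      · intro i; have := hlu i; split_ifs <;> omega
      · intro i; have := hu i; split_ifs <;> omega
      · intro i j; have := hk j; rw [hr]; split_ifs <;> omega

/-- Every finite interval order has a compressed representation. -/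
theorem exists_isCompressedRep {V : Type*} [Fintype V] (r : V → V → Prop) (a b : V → ℝ)
    (hab : ∀ i, a i ≤ b i) (hr : ∀ i j, r i j ↔ b i < a j) :
    ∃ l u m, IsCompressedRep r l u m := by
  classical
  let S : Finset ℝ := Finset.univ.image a ∪ Finset.univ.image b
  let rank : ℝ → ℕ := fun x => (S.filter (· ≤ x)).card
  have rank_mono {x y : ℝ} (h : x ≤ y) : rank x ≤ rank y := by
    refine Finset.card_le_card fun z hz => ?_
    rw [Finset.mem_filter] at hz ⊢
    exact ⟨hz.1, hz.2.trans h⟩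
  have ha (i : V) : a i ∈ S := by simp [S]
  have rank_lt {x : ℝ} {i : V} (h : x < a i) : rank x < rank (a i) := by
    refine Finset.card_lt_card (Finset.ssubset_iff_of_subset (fun z hz => ?_) |>.2
      ⟨a i, by simp [ha], by simp [h]⟩)
    rw [Finset.mem_filter] at hz ⊢
    exact ⟨hz.1, hz.2.trans h.le⟩
  refine exists_isCompressedRep_of_nat r (S.card + 1) (fun i => rank (a i)) (fun i => rank (b i))
    (by omega) (fun i => ?_) (fun i => rank_mono (hab i)) (fun i => ?_) (fun i j => ?_)
  · exact Finset.card_pos.2 ⟨a i, by simp [ha]⟩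
  · exact (Finset.card_le_card (Finset.filter_subset _ _)).trans (Nat.le_succ _)
  · rw [hr]
    refine ⟨rank_lt, fun h => ?_⟩
    by_contra! h'
    exact absurd (rank_mono h') (by omega)

/-- A family of intervals `[l i, h i]` in `{1, …, m}` that can be read off from left to right from
its intersection graph, once the intervals with left endpoint `1` are known. -/
structure IsLeftReadable {V : Type*} (l h : V → ℕ) (m : ℕ) : Prop where
  one_le_size : 1 ≤ m
  one_le_left (i : V) : 1 ≤ l i
  left_le_right (i : V) : l i ≤ h i
  right_le_size (i : V) : h i ≤ m
  exists_left_eq (k : ℕ) : 2 ≤ k → k ≤ m → ∃ i, l i = k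
  exists_right_eq (k : ℕ) : 2 ≤ k → k < m → ∃ i, h i = k ∧ l i < k

namespace IsLeftReadable

variable {V : Type*} {l h l' h' : V → ℕ} {m m' : ℕ}

theorem left_le_succ (H : IsLeftReadable l h m) (H' : IsLeftReadable l' h' m')
    (hadj : ∀ i j, i ≠ j → ((l i ≤ h j ∧ l j ≤ h i) ↔ (l' i ≤ h' j ∧ l' j ≤ h' i)))
    {k : ℕ} (hk : 1 ≤ k) (ih : ∀ i, l i ≤ k ↔ l' i ≤ k) {i : V} (hi : l i ≤ k + 1) :
    l' i ≤ k + 1 := by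
  by_contra! hlt
  have hi' := (H'.left_le_right i).trans (H'.right_le_size i)
  obtain ⟨j, hj, hjk⟩ := H'.exists_right_eq (k + 1) (by omega) (by omega)
  obtain ⟨j₂, hj₂⟩ := H'.exists_left_eq (k + 1) (by omega) (by omega)
  have hij : i ≠ j := by rintro rfl; omega
  have hjj₂ : j ≠ j₂ := by rintro rfl; omega
  have := hadj i j hij
  have := hadj j j₂ hjj₂
  have := ih i
  have := ih j
  have := ih j₂
  have := H.left_le_right i
  have := H'.left_le_right j₂
  omega

theorem left_eq (H : IsLeftReadable l h m) (H' : IsLeftReadable l' h' m')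
    (hone : ∀ i, l i ≤ 1 ↔ l' i ≤ 1)
    (hadj : ∀ i j, i ≠ j → ((l i ≤ h j ∧ l j ≤ h i) ↔ (l' i ≤ h' j ∧ l' j ≤ h' i))) :
    l = l' := by
  have key (k : ℕ) : ∀ i, l i ≤ k + 1 ↔ l' i ≤ k + 1 := by
    induction k with
    | zero => exact hone
    | succ k ih =>
      exact fun i => ⟨H.left_le_succ H' hadj (by omega) ih,
        H'.left_le_succ H (fun i j hij => (hadj i j hij).symm) (by omega) fun i => (ih i).symm⟩
  funext i
  have := H.one_le_left i
  have := H'.one_le_left i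
  have := key (l i - 1) i
  have := key (l' i - 1) i
  omega

theorem size_le (H : IsLeftReadable l h m) (H' : IsLeftReadable l h' m') : m ≤ m' := by
  by_contra! hlt
  have := H'.one_le_size
  obtain ⟨i, hi⟩ := H.exists_left_eq m (by omega) le_rfl
  have := H'.left_le_right i
  have := H'.right_le_size i
  omega

theorem right_le (H : IsLeftReadable l h m) (H' : IsLeftReadable l h' m')
    (hadj : ∀ i j, i ≠ j → ((l i ≤ h j ∧ l j ≤ h i) ↔ (l i ≤ h' j ∧ l j ≤ h' i))) (i : V) :
    h i ≤ h' i := by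
  by_contra! hlt
  have := H'.left_le_right i
  have := H.one_le_left i
  obtain ⟨j, hj⟩ := H.exists_left_eq (h i) (by omega) (H.right_le_size i)
  have hij : i ≠ j := by rintro rfl; omega
  have := hadj i j hij
  have := H.left_le_right j
  omega

theorem ext (H : IsLeftReadable l h m) (H' : IsLeftReadable l' h' m')
    (hone : ∀ i, l i ≤ 1 ↔ l' i ≤ 1)
    (hadj : ∀ i j, i ≠ j → ((l i ≤ h j ∧ l j ≤ h i) ↔ (l' i ≤ h' j ∧ l' j ≤ h' i))) :
    l = l' ∧ h = h' ∧ m = m' := by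
  obtain rfl := H.left_eq H' hone hadj
  exact ⟨rfl, funext fun i => (H.right_le H' hadj i).antisymm
    (H'.right_le H (fun i j hij => (hadj i j hij).symm) i), (H.size_le H').antisymm (H'.size_le H)⟩

end IsLeftReadable

/-- The right endpoint that replaces the right endpoint `u` of an interval `[l, u]` in
`{1, …, m}`: endpoints below `m - 1` move one step to the right, and intervals ending at `m - 1`
shrink to points. -/
def shiftRight (m l u : ℕ) : ℕ :=
  if u = m then m else if u + 1 = m then l else u + 1

theorem shiftRight_injective {m l u v : ℕ} (hlu : l ≤ u) (hlv : l ≤ v)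
    (h : shiftRight m l u = shiftRight m l v) : u = v := by
  unfold shiftRight at h
  split_ifs at h <;> omega

theorem IsCompressedRep.isLeftReadable {V : Type*} {r : V → V → Prop} {l u : V → ℕ} {m : ℕ}
    (H : IsCompressedRep r l u m) : IsLeftReadable l (fun i => shiftRight m (l i) (u i)) m where
  one_le_size := H.one_le_size
  one_le_left := H.one_le_left
  left_le_right i := by
    have := H.left_le_right i
    have := H.right_le_size i
    unfold shiftRight
    split_ifs <;> omega
  right_le_size i := by
    have := H.left_le_right i
    have := H.right_le_size i
    unfold shiftRight
    split_ifs <;> omega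
  exists_left_eq := H.exists_left_eq
  exists_right_eq k hk hkm := by
    obtain ⟨i, hi⟩ := H.exists_right_eq (k - 1) (by omega) (by omega)
    have := H.left_le_right i
    refine ⟨i, ?_, by omega⟩
    unfold shiftRight
    split_ifs <;> omega

/-- The intersection graph of the intervals `[l i, h i]`. -/
def natIntervalGraph {V : Type*} (l h : V → ℕ) : SimpleGraph V where
  Adj i j := i ≠ j ∧ l i ≤ h j ∧ l j ≤ h i
  symm := ⟨fun _ _ hij => ⟨hij.1.symm, hij.2.2, hij.2.1⟩⟩
  loopless := ⟨fun _ hi => hi.1 rfl⟩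

theorem natIntervalGraph_adj_iff_nonempty {V : Type*} {l h : V → ℕ} (hlh : ∀ i, l i ≤ h i)
    (i j : V) : (natIntervalGraph l h).Adj i j ↔
      i ≠ j ∧ (Set.Icc (l i : ℝ) (h i) ∩ Set.Icc (l j : ℝ) (h j)).Nonempty := by
  have := hlh i
  have := hlh j
  rw [Set.Icc_inter_Icc, Set.nonempty_Icc]
  simp only [natIntervalGraph, sup_le_iff, le_inf_iff, Nat.cast_le]
  tauto

/-- g(n−1) ≤ f₁(n). -/
theorem intervalOrders_le_intervalGraphs (n : ℕ) (hn : 1 ≤ n) :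
    numIntervalOrders (n - 1) ≤ numIntervalGraphs n := by
  obtain ⟨N, rfl⟩ : ∃ N, n = N + 1 := ⟨n - 1, by omega⟩
  rw [Nat.add_sub_cancel]
  have hrep (r : Fin N → Fin N → Prop) : ∃ l u m,
      (∃ a b : Fin N → ℝ, (∀ k, a k ≤ b k) ∧ ∀ i j, r i j ↔ b i < a j) →
        IsCompressedRep r l u m := by
    by_cases h : ∃ a b : Fin N → ℝ, (∀ k, a k ≤ b k) ∧ ∀ i j, r i j ↔ b i < a j
    · obtain ⟨a, b, hab, hr⟩ := h
      obtain ⟨l, u, m, H⟩ := exists_isCompressedRep r a b hab hr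
      exact ⟨l, u, m, fun _ => H⟩
    · exact ⟨0, 0, 0, fun h' => absurd h' h⟩
  choose l u m H using hrep
  let lo : (Fin N → Fin N → Prop) → Fin (N + 1) → ℕ := fun r => Fin.snoc (α := fun _ => ℕ) (l r) 1
  let hi : (Fin N → Fin N → Prop) → Fin (N + 1) → ℕ := fun r =>
    Fin.snoc (α := fun _ => ℕ) (fun i => shiftRight (m r) (l r i) (u r i)) 1
  refine Set.ncard_le_ncard_of_injOn (fun r => natIntervalGraph (lo r) (hi r)) ?_ ?_
    (Set.toFinite _)
  · intro r hr
    have hlh (i : Fin (N + 1)) : lo r i ≤ hi r i := by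
      refine Fin.lastCases ?_ (fun i => ?_) i
      · simp [lo, hi]
      · simpa [lo, hi] using (H r hr).isLeftReadable.left_le_right i
    exact ⟨fun i => lo r i, fun i => hi r i, fun i => Nat.cast_le.2 (hlh i),
      natIntervalGraph_adj_iff_nonempty hlh⟩
  · intro r hr r' hr' heq
    have C := H r hr
    have C' := H r' hr'
    have hadj (i j : Fin (N + 1)) : (natIntervalGraph (lo r) (hi r)).Adj i j ↔
        (natIntervalGraph (lo r') (hi r')).Adj i j := by
      rw [show natIntervalGraph (lo r) (hi r) = natIntervalGraph (lo r') (hi r') from heq]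
    obtain ⟨hl, hh, hm⟩ := C.isLeftReadable.ext C'.isLeftReadable
      (fun i => by
        have h₁ := (C.one_le_left i).trans (C.isLeftReadable.left_le_right i)
        have h₂ := (C'.one_le_left i).trans (C'.isLeftReadable.left_le_right i)
        simpa [natIntervalGraph, lo, hi, (Fin.castSucc_lt_last i).ne, h₁, h₂] using
          hadj i.castSucc (Fin.last N))
      (fun i j hij => by
        simpa [natIntervalGraph, lo, hi, hij] using hadj i.castSucc j.castSucc)
    have hu : u r = u r' := by
      funext i
      have h := congrFun hh i
      simp only [hl, hm] at h
      exact shiftRight_injective (hl ▸ C.left_le_right i) (C'.left_le_right i) h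
    funext i j
    exact propext (by rw [C.rel_iff, C'.rel_iff, hl, hu])
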